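/- Let (f_μ)_{μ∈[0,1]} be a family of C^1 maps of ℝ, continuous in the strong C^1 topology at every parameter, and let p ∈ ℝ be such that for every μ ∈ [0,1], f_μ(p) = p and |f_μ'(p)| > 1. Suppose f_0 has at least one regular homoclinic orbit associated to p, and f_1 has no homoclinic orbit associated to p. Let μ₀ = sup{μ ∈ [0,1] : f_μ has a regular homoclinic orbit associated to p}. Let a(μ) = inf W^u_{f_μ}(p) and b(μ) = sup W^u_{f_μ}(p), with values in the extended reals [−∞, +∞]. Then at least one of the following holds: (1) a or b is discontinuous at μ₀; (2) f_{μ₀} has at least one critical homoclinic orbit associated to p and has no regular homoclinic orbit associated to p. -/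

import Mathlib

open Filter Set

/-- The unstable set of `p` under `g`: the points having a preorbit converging to `p`. -/
def unstableSet (g : ℝ → ℝ) (p : ℝ) : Set ℝ :=
  {y | ∃ s : ℕ → ℝ, s 0 = y ∧ (∀ n : ℕ, g (s (n + 1)) = s n) ∧ Tendsto s atTop (nhds p)}

section LocalExpansion

variable {g : ℝ → ℝ} {p r l σ : ℝ}

lemma mul_sub_le_of_le_deriv (hg : Differentiable ℝ g)
    (hd : ∀ x ∈ Icc (p - r) (p + r), l ≤ σ * deriv g x) {x y : ℝ}
    (hx : x ∈ Icc (p - r) (p + r)) (hy : y ∈ Icc (p - r) (p + r)) (hxy : x ≤ y) :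
    l * (y - x) ≤ σ * g y - σ * g x := by
  refine (convex_Icc (p - r) (p + r)).mul_sub_le_image_sub_of_le_deriv
    (f := fun z => σ * g z) (continuous_const.mul hg.continuous).continuousOn
    (hg.const_mul σ).differentiableOn ?_ x hx y hy hxy
  intro z hz
  rw [deriv_const_mul σ (hg z)]
  exact hd z (interior_subset hz)

lemma mul_abs_sub_le_of_le_deriv (hg : Differentiable ℝ g) (hσ : |σ| = 1)
    (hd : ∀ x ∈ Icc (p - r) (p + r), l ≤ σ * deriv g x) {x y : ℝ}
    (hx : x ∈ Icc (p - r) (p + r)) (hy : y ∈ Icc (p - r) (p + r)) :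
    l * |x - y| ≤ |g x - g y| := by
  have key : ∀ {u v : ℝ}, σ * u - σ * v ≤ |u - v| := fun {u v} => by
    rw [← mul_sub]
    refine (le_abs_self _).trans ?_
    rw [abs_mul, hσ, one_mul]
  rcases le_total x y with h | h
  · rw [abs_sub_comm, abs_of_nonneg (sub_nonneg.2 h), abs_sub_comm (g x)]
    exact (mul_sub_le_of_le_deriv hg hd hx hy h).trans key
  · rw [abs_of_nonneg (sub_nonneg.2 h)]
    exact (mul_sub_le_of_le_deriv hg hd hy hx h).trans key

lemma exists_preimage_of_le_deriv (hg : Differentiable ℝ g) (hσ : |σ| = 1) (hr : 0 < r)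
    (hl : 1 < l) (hp : g p = p) (hd : ∀ x ∈ Icc (p - r) (p + r), l ≤ σ * deriv g x) {y : ℝ}
    (hy : y ∈ Icc (p - r) (p + r)) :
    ∃ x ∈ Icc (p - r) (p + r), g x = y ∧ l * |x - p| ≤ |y - p| := by
  have hpm : p ∈ Icc (p - r) (p + r) := ⟨by linarith, by linarith⟩
  have hlm : p - r ∈ Icc (p - r) (p + r) := ⟨by linarith, by linarith⟩
  have hrm : p + r ∈ Icc (p - r) (p + r) := ⟨by linarith, by linarith⟩
  have h1 := mul_sub_le_of_le_deriv hg hd hlm hpm (by linarith)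
  have h2 := mul_sub_le_of_le_deriv hg hd hpm hrm (by linarith)
  have hσy : |σ * y - σ * p| ≤ r := by
    rw [← mul_sub, abs_mul, hσ, one_mul, abs_le]
    constructor <;> linarith [hy.1, hy.2]
  rw [hp] at h1 h2
  rw [abs_le] at hσy
  have hlr : r ≤ l * r := by nlinarith
  obtain ⟨x, hx, hxy⟩ := intermediate_value_Icc (f := fun z => σ * g z)
    (by linarith : p - r ≤ p + r) (continuous_const.mul hg.continuous).continuousOn
    (⟨by linarith, by linarith⟩ : σ * y ∈ Icc (σ * g (p - r)) (σ * g (p + r)))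
  have hσ0 : σ ≠ 0 := by rintro rfl; simp at hσ
  have hxy' : g x = y := mul_left_cancel₀ hσ0 hxy
  refine ⟨x, hx, hxy', ?_⟩
  have := mul_abs_sub_le_of_le_deriv hg hσ hd hx hpm
  rwa [hp, hxy'] at this

lemma exists_local_preorbit (hg : Differentiable ℝ g) (hσ : |σ| = 1) (hr : 0 < r)
    (hl : 1 < l) (hp : g p = p) (hd : ∀ x ∈ Icc (p - r) (p + r), l ≤ σ * deriv g x) {y : ℝ}
    (hy : y ∈ Icc (p - r) (p + r)) :
    ∃ s : ℕ → ℝ, s 0 = y ∧ (∀ n, g (s (n + 1)) = s n) ∧ Tendsto s atTop (nhds p) ∧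
      ∀ n, s n ∈ Icc (p - r) (p + r) := by
  have H : ∀ y, ∃ x, y ∈ Icc (p - r) (p + r) →
      x ∈ Icc (p - r) (p + r) ∧ g x = y ∧ l * |x - p| ≤ |y - p| := fun y => by
    by_cases hy : y ∈ Icc (p - r) (p + r)
    · obtain ⟨x, hx⟩ := exists_preimage_of_le_deriv hg hσ hr hl hp hd hy
      exact ⟨x, fun _ => hx⟩
    · exact ⟨0, fun h => absurd h hy⟩
  choose c hc using H
  have hmem : ∀ n, c^[n] y ∈ Icc (p - r) (p + r) := fun n => by
    induction n with
    | zero => exact hy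
    | succ n ih => rw [Function.iterate_succ_apply']; exact (hc _ ih).1
  refine ⟨fun n => c^[n] y, rfl, fun n => ?_, ?_, hmem⟩
  · simp only [Function.iterate_succ_apply']
    exact (hc _ (hmem n)).2.1
  · have hl0 : 0 < l := by linarith
    have hbound : ∀ n, |c^[n] y - p| ≤ |y - p| * (l⁻¹) ^ n := fun n => by
      induction n with
      | zero => simp
      | succ n ih =>
        have h := (hc _ (hmem n)).2.2
        rw [Function.iterate_succ_apply', pow_succ, ← mul_assoc, ← div_eq_mul_inv,
          le_div_iff₀ hl0, mul_comm]
        exact h.trans ih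
    have hlim : Tendsto (fun n : ℕ => |y - p| * (l⁻¹) ^ n) atTop (nhds 0) := by
      simpa using (tendsto_pow_atTop_nhds_zero_of_lt_one (inv_nonneg.2 hl0.le)
        (inv_lt_one_of_one_lt₀ hl)).const_mul |y - p|
    rw [tendsto_iff_dist_tendsto_zero]
    exact squeeze_zero (fun _ => dist_nonneg) hbound hlim

lemma Icc_subset_unstableSet (hg : Differentiable ℝ g) (hσ : |σ| = 1) (hr : 0 < r)
    (hl : 1 < l) (hp : g p = p) (hd : ∀ x ∈ Icc (p - r) (p + r), l ≤ σ * deriv g x) :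
    Icc (p - r) (p + r) ⊆ unstableSet g p := fun y hy => by
  obtain ⟨s, h0, h1, h2, -⟩ := exists_local_preorbit hg hσ hr hl hp hd hy
  exact ⟨s, h0, h1, h2⟩

lemma exists_forall_le_eq_of_tendsto_atBot (hg : Differentiable ℝ g) (hσ : |σ| = 1) (hr : 0 < r)
    (hl : 1 < l) (hp : g p = p) (hd : ∀ x ∈ Icc (p - r) (p + r), l ≤ σ * deriv g x)
    {x : ℤ → ℝ} (hx : ∀ n, g (x (n + 1)) = x n) (hlim : Tendsto x atBot (nhds p)) :
    ∃ N, ∀ n ≤ N, x n = p := by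
  have hpm : p ∈ Icc (p - r) (p + r) := ⟨by linarith, by linarith⟩
  obtain ⟨N, hN⟩ := eventually_atBot.1
    (hlim.eventually_mem (Icc_mem_nhds (by linarith : p - r < p) (by linarith : p < p + r)))
  refine ⟨N, fun n hn => ?_⟩
  have hmono : ∀ k : ℕ, |x n - p| ≤ |x (n - k) - p| := fun k => by
    induction k with
    | zero => simp
    | succ k ih =>
      refine ih.trans ?_
      have h := mul_abs_sub_le_of_le_deriv hg hσ hd (hN (n - k) (by omega)) hpm
      have h2 := hx (n - (k + 1))
      rw [show n - ((k : ℤ) + 1) + 1 = n - k by ring] at h2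
      rw [h2, hp] at h
      push_cast
      nlinarith [abs_nonneg (x (n - k) - p)]
  have hk : Tendsto (fun k : ℕ => n - (k : ℤ)) atTop atBot := by
    refine tendsto_atBot.2 fun m => ?_
    filter_upwards [eventually_ge_atTop (n - m).toNat] with k hk
    omega
  have h0 : Tendsto (fun k : ℕ => |x (n - k) - p|) atTop (nhds 0) := by
    simpa using ((hlim.comp hk).sub_const p).abs
  have := ge_of_tendsto' h0 hmono
  exact sub_eq_zero.1 (abs_eq_zero.1 (le_antisymm this (abs_nonneg _)))

end LocalExpansion

section Orbits

variable {g : ℝ → ℝ} {p : ℝ}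

lemma apply_iterate_of_backward_orbit {x : ℤ → ℝ} (hx : ∀ n, g (x (n + 1)) = x n) (k : ℕ)
    (n : ℤ) : g^[k] (x n) = x (n - k) := by
  induction k with
  | zero => simp
  | succ k ih =>
    rw [Function.iterate_succ_apply', ih, ← hx (n - (k + 1 : ℕ))]
    congr 2
    push_cast
    ring

lemma apply_iterate_of_preorbit {s : ℕ → ℝ} (hs : ∀ n, g (s (n + 1)) = s n) (k : ℕ) :
    g^[k] (s k) = s 0 := by
  induction k with
  | zero => rfl
  | succ k ih => rw [Function.iterate_succ_apply, hs, ih]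

lemma self_mem_unstableSet (hp : g p = p) : p ∈ unstableSet g p :=
  ⟨fun _ => p, rfl, fun _ => hp, tendsto_const_nhds⟩

lemma apply_mem_unstableSet {y : ℝ} (hy : y ∈ unstableSet g p) : g y ∈ unstableSet g p := by
  obtain ⟨s, rfl, h1, h2⟩ := hy
  refine ⟨fun n => Nat.casesOn n (g (s 0)) s, rfl, fun n => ?_, ?_⟩
  · cases n with
    | zero => rfl
    | succ n => exact h1 n
  · rw [← tendsto_add_atTop_iff_nat 1]
    exact h2

lemma iterate_mem_unstableSet {y : ℝ} (hy : y ∈ unstableSet g p) (k : ℕ) :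
    g^[k] y ∈ unstableSet g p := by
  induction k with
  | zero => exact hy
  | succ k ih => rw [Function.iterate_succ_apply']; exact apply_mem_unstableSet ih

lemma image_unstableSet : g '' unstableSet g p = unstableSet g p := by
  ext y
  constructor
  · rintro ⟨x, hx, rfl⟩
    exact apply_mem_unstableSet hx
  · rintro ⟨s, rfl, h1, h2⟩
    exact ⟨s 1, ⟨fun n => s (n + 1), rfl, fun n => h1 (n + 1),
      (tendsto_add_atTop_iff_nat 1).2 h2⟩, h1 0⟩

lemma ordConnected_unstableSet (hg : Continuous g) (hp : g p = p) {r : ℝ} (hr : 0 < r)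
    (hW : Icc (p - r) (p + r) ⊆ unstableSet g p) : (unstableSet g p).OrdConnected := by
  have hpm : p ∈ Icc (p - r) (p + r) := ⟨by linarith, by linarith⟩
  have key : ∀ y ∈ unstableSet g p, uIcc p y ⊆ unstableSet g p := by
    rintro y ⟨s, rfl, h1, h2⟩ z hz
    obtain ⟨N, hN⟩ := (h2.eventually_mem
      (Icc_mem_nhds (by linarith : p - r < p) (by linarith : p < p + r))).exists
    have himg := intermediate_value_uIcc (a := p) (b := s N) (hg.iterate N).continuousOn
    rw [apply_iterate_of_preorbit h1, Function.iterate_fixed hp] at himg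
    obtain ⟨w, hw, rfl⟩ := himg hz
    exact iterate_mem_unstableSet (hW (ordConnected_Icc.uIcc_subset hpm hN hw)) N
  refine ⟨fun x hx y hy z hz => ?_⟩
  rcases le_total z p with h | h
  · exact key x hx (mem_uIcc.2 (Or.inr ⟨hz.1, h⟩))
  · exact key y hy (mem_uIcc.2 (Or.inl ⟨h, hz.2⟩))

lemma exists_biinfinite_orbit (hp : g p = p) {s : ℕ → ℝ} (hs : ∀ n, g (s (n + 1)) = s n)
    (hlim : Tendsto s atTop (nhds p)) {M : ℕ} (hM : g^[M] (s 0) = p) :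
    ∃ x : ℤ → ℝ, (∀ n, g (x (n + 1)) = x n) ∧ Tendsto x atTop (nhds p) ∧
      Tendsto x atBot (nhds p) ∧ x 0 = s 0 ∧
      ∀ n, (∃ k, x n = s k) ∨ (∃ k < M, x n = g^[k] (s 0)) ∨ x n = p := by
  have hge : ∀ k, M ≤ k → g^[k] (s 0) = p := fun k hk => by
    obtain ⟨j, rfl⟩ := Nat.exists_eq_add_of_le' hk
    rw [Function.iterate_add_apply, hM, Function.iterate_fixed hp]
  let x : ℤ → ℝ := fun n => Int.rec s (fun k => g^[k + 1] (s 0)) n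
  have hpos : ∀ k : ℕ, x k = s k := fun _ => rfl
  have hneg : ∀ k : ℕ, x (Int.negSucc k) = g^[k + 1] (s 0) := fun _ => rfl
  refine ⟨x, ?_, ?_, ?_, rfl, ?_⟩
  · rintro (n | _ | n)
    · exact hs n
    · rfl
    · rw [hneg, Function.iterate_succ_apply']
      rfl
  · rw [← Nat.map_cast_int_atTop, tendsto_map'_iff]
    exact hlim
  · refine tendsto_const_nhds.congr' ?_
    filter_upwards [eventually_le_atBot (-(M : ℤ) - 1)] with n hn
    rcases n with n | n
    · have : (Int.ofNat n) = (n : ℤ) := rfl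
      omega
    · rw [hneg, hge]
      omega
  · rintro (n | n)
    · exact Or.inl ⟨n, rfl⟩
    · right
      rcases lt_or_ge (n + 1) M with h | h
      · exact Or.inl ⟨n + 1, h, rfl⟩
      · exact Or.inr (hge _ h)

lemma exists_mem_unstableSet_apply_eq {x : ℤ → ℝ} (hx : ∀ n, g (x (n + 1)) = x n)
    (htop : Tendsto x atTop (nhds p)) (hne : ∃ N, x N ≠ p) (hbot : ∃ N, ∀ n ≤ N, x n = p) :
    ∃ q ∈ unstableSet g p, q ≠ p ∧ g q = p := by
  obtain ⟨N, hN⟩ := hbot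
  obtain ⟨m, hm, hmin⟩ := Int.exists_least_of_bdd (P := fun n => x n ≠ p)
    ⟨N, fun z hz => le_of_not_ge fun h => hz (hN z h)⟩ hne
  refine ⟨x m, ⟨fun k => x (m + k), by simp, fun k => ?_, ?_⟩, hm, ?_⟩
  · change g (x (m + ((k + 1 : ℕ) : ℤ))) = x (m + k)
    rw [← hx (m + k)]
    congr 2
    push_cast
    ring
  · exact htop.comp (tendsto_atTop_add_const_left _ _ tendsto_natCast_atTop_atTop)
  · have h := hx (m - 1)
    rw [sub_add_cancel] at h
    rw [h]
    by_contra hc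
    have := hmin _ hc
    omega

end Orbits

section Endpoints

variable {α : Type*} [ConditionallyCompleteLinearOrder α] [DenselyOrdered α] [TopologicalSpace α]
  [OrderTopology α] {g : α → α} {W : Set α} {p : α}

lemma apply_ne_of_isLUB (hg : Continuous g) (hW : W.OrdConnected) (himg : g '' W = W)
    (hpW : p ∈ W) (hinj : ∀ q ∈ W, g q = p → q = p) {β : α} (hβ : IsLUB W β) (hpβ : p < β) :
    g β ≠ p := by
  intro hgβ
  have hmap : ∀ x ∈ W, g x ∈ W := fun x hx => himg ▸ mem_image_of_mem g hx
  set M : Set α := g '' Icc p β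
  have hMW : M ⊆ W := by
    rintro _ ⟨x, hx, rfl⟩
    rcases hx.2.eq_or_lt with rfl | hlt
    · rwa [hgβ]
    · obtain ⟨y, hy, hxy⟩ := (lt_isLUB_iff hβ).1 hlt
      exact hmap x (hW.out hpW hy ⟨hx.1, hxy.le⟩)
  have hMc : IsCompact M := isCompact_Icc.image hg
  have hsub : W ⊆ Iic p ∪ (M ∪ g '' M) := by
    intro y hy
    rcases le_or_gt y p with hyp | hyp
    · exact Or.inl hyp
    right
    obtain ⟨v, hv, rfl⟩ := himg.symm ▸ hy
    rcases le_or_gt p v with hpv | hvp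
    · exact Or.inl (mem_image_of_mem g ⟨hpv, hβ.1 hv⟩)
    obtain ⟨u, hu, rfl⟩ := himg.symm ▸ hv
    rcases le_or_gt p u with hpu | hup
    · exact Or.inr (mem_image_of_mem g (mem_image_of_mem g ⟨hpu, hβ.1 hu⟩))
    exfalso
    obtain ⟨w, hw, hwp⟩ := intermediate_value_uIcc (a := u) (b := g u) hg.continuousOn
      (mem_uIcc.2 (Or.inl ⟨hvp.le, hyp.le⟩))
    have hwp' := hinj w (hW.uIcc_subset hu hv hw) hwp
    have : w < p := hw.2.trans_lt (max_lt hup hvp)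
    exact this.ne hwp'
  have hcl : IsClosed (Iic p ∪ (M ∪ g '' M)) :=
    isClosed_Iic.union (hMc.isClosed.union (hMc.image hg).isClosed)
  have hβW : β ∈ W := by
    rcases closure_minimal hsub hcl (hβ.mem_closure ⟨p, hpW⟩) with h | h | h
    · exact absurd h (not_le.2 hpβ)
    · exact hMW h
    · obtain ⟨z, hz, rfl⟩ := h
      exact hmap z (hMW hz)
  exact hpβ.ne' (hinj β hβW hgβ)

lemma Ici_subset_or_exists_forall_Ioc_apply_ne [NoMaxOrder α] (hg : Continuous g)
    (hW : W.OrdConnected)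
    (himg : g '' W = W) (hpW : p ∈ W) (hinj : ∀ q ∈ W, g q = p → q = p) (hp : ∃ q ∈ W, p < q) :
    Ici p ⊆ W ∨ ∃ β β', β < β' ∧ β ∈ upperBounds W ∧ ∀ x ∈ Ioc p β', g x ≠ p := by
  by_cases hb : BddAbove W
  · right
    have hβ := isLUB_csSup ⟨p, hpW⟩ hb
    set β := sSup W
    obtain ⟨q, hq, hpq⟩ := hp
    have hne := apply_ne_of_isLUB hg hW himg hpW hinj hβ (hpq.trans_le (hβ.1 hq))
    obtain ⟨γ, hγ, hIco⟩ := exists_Ico_subset_of_mem_nhds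
      (hg.continuousAt.eventually_ne hne) (exists_gt β)
    obtain ⟨β', h1, h2⟩ := exists_between hγ
    refine ⟨β, β', h1, hβ.1, fun x hx => ?_⟩
    rcases le_or_gt β x with h | h
    · exact hIco ⟨h, hx.2.trans_lt h2⟩
    · obtain ⟨y, hy, hxy⟩ := (lt_isLUB_iff hβ).1 h
      exact fun hgx => hx.1.ne' (hinj x (hW.out hpW hy ⟨hx.1.le, hxy.le⟩) hgx)
  · left
    intro x hx
    obtain ⟨y, hy, hxy⟩ := not_bddAbove_iff.1 hb x
    exact hW.out hpW hy ⟨hx, hxy.le⟩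

lemma Iic_subset_or_exists_forall_Ico_apply_ne [NoMinOrder α] (hg : Continuous g)
    (hW : W.OrdConnected)
    (himg : g '' W = W) (hpW : p ∈ W) (hinj : ∀ q ∈ W, g q = p → q = p) (hp : ∃ q ∈ W, q < p) :
    Iic p ⊆ W ∨ ∃ β β', β' < β ∧ β ∈ lowerBounds W ∧ ∀ x ∈ Ico β' p, g x ≠ p := by
  rcases Ici_subset_or_exists_forall_Ioc_apply_ne (α := αᵒᵈ) (g := g) (W := W) (p := p) hg
    hW.dual himg hpW hinj hp with h | ⟨β, β', h1, h2, h3⟩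
  · exact Or.inl h
  · exact Or.inr ⟨β, β', h1, h2, fun x hx => h3 x ⟨hx.2, hx.1⟩⟩

end Endpoints

section Families

variable {I : Set ℝ} {f : ℝ → ℝ → ℝ}

lemma continuousOn_uncurry_of_uniform {G : ℝ → ℝ → ℝ} (hG : ∀ μ ∈ I, Continuous (G μ))
    (hu : ∀ μ₁ ∈ I, ∀ ε > (0 : ℝ), ∃ δ > (0 : ℝ), ∀ μ ∈ I, |μ - μ₁| < δ →
      ∀ x, |G μ x - G μ₁ x| < ε) :
    ContinuousOn (fun z : ℝ × ℝ => G z.1 z.2) (I ×ˢ univ) := by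
  rintro ⟨μ₁, x₁⟩ ⟨hμ₁, -⟩
  rw [ContinuousWithinAt, nhdsWithin_prod_eq, nhdsWithin_univ, Metric.tendsto_nhds]
  intro ε hε
  obtain ⟨δ, hδ, h⟩ := hu μ₁ hμ₁ (ε / 2) (half_pos hε)
  have h1 : ∀ᶠ μ in nhdsWithin μ₁ I, ∀ x, |G μ x - G μ₁ x| < ε / 2 := by
    filter_upwards [self_mem_nhdsWithin, mem_nhdsWithin_of_mem_nhds (Metric.ball_mem_nhds μ₁ hδ)]
      with μ hμ hμδ
    exact h μ hμ hμδ
  have h2 : ∀ᶠ x in nhds x₁, |G μ₁ x - G μ₁ x₁| < ε / 2 :=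
    Metric.tendsto_nhds.1 (hG μ₁ hμ₁).continuousAt _ (half_pos hε)
  filter_upwards [h1.prod_mk h2] with z hz
  have := abs_sub_le (G z.1 z.2) (G μ₁ z.2) (G μ₁ x₁)
  have := hz.1 z.2
  have := hz.2
  rw [Real.dist_eq]
  linarith

lemma continuousOn_uncurry_iterate
    (hf : ContinuousOn (fun z : ℝ × ℝ => f z.1 z.2) (I ×ˢ univ)) (k : ℕ) :
    ContinuousOn (fun z : ℝ × ℝ => (f z.1)^[k] z.2) (I ×ˢ univ) := by
  induction k with
  | zero => exact continuousOn_snd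
  | succ k ih =>
    simp only [Function.iterate_succ_apply']
    exact hf.comp (continuousOn_fst.prodMk ih) fun z hz => ⟨hz.1, mem_univ _⟩

lemma exists_uniform_expansion {D : ℝ → ℝ → ℝ} {p μ₁ : ℝ}
    (hD : ContinuousOn (fun z : ℝ × ℝ => D z.1 z.2) (I ×ˢ univ)) (hμ₁ : μ₁ ∈ I)
    (hp : 1 < |D μ₁ p|) :
    ∃ r l σ : ℝ, 0 < r ∧ 1 < l ∧ |σ| = 1 ∧
      ∀ᶠ μ in nhdsWithin μ₁ I, ∀ x ∈ Icc (p - r) (p + r), l ≤ σ * D μ x := by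
  obtain ⟨σ, hσ, hσD⟩ : ∃ σ : ℝ, |σ| = 1 ∧ 1 < σ * D μ₁ p := by
    rcases lt_abs.1 hp with h | h
    · exact ⟨1, by simp, by simpa⟩
    · exact ⟨-1, by simp, by simpa⟩
  obtain ⟨l, hl, hlD⟩ := exists_between hσD
  have h := (continuousOn_const (c := σ)).mul hD (μ₁, p) ⟨hμ₁, mem_univ _⟩
  have h' := h.eventually_const_lt hlD
  rw [nhdsWithin_prod_eq, nhdsWithin_univ] at h'
  obtain ⟨P, hP, Q, hQ, hPQ⟩ := eventually_prod_iff.1 h'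
  obtain ⟨r, hr, hrQ⟩ := Metric.nhds_basis_closedBall.eventually_iff.1 hQ
  rw [Real.closedBall_eq_Icc] at hrQ
  exact ⟨r, l, σ, hr, hl, hσ, hP.mono fun μ hμ x hx => (hPQ hμ (hrQ hx)).le⟩

lemma map_iterate_nhds {g : ℝ → ℝ} (hg : ContDiff ℝ 1 g) {y : ℝ} {M : ℕ}
    (h : ∀ j < M, deriv g (g^[j] y) ≠ 0) : map g^[M] (nhds y) = nhds (g^[M] y) := by
  induction M with
  | zero => exact map_id
  | succ M ih =>
    rw [Function.iterate_succ', ← map_map, ih fun j hj => h j (hj.trans M.lt_succ_self),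
      Function.comp_apply]
    exact (hg.contDiffAt.hasStrictDerivAt one_ne_zero).map_nhds_eq (h M M.lt_succ_self)

/-- A transverse connection from a point near a repelling fixed point `p` back to `p` persists. -/
lemma eventually_exists_iterate_eq {p x₀ μ₁ : ℝ} {U : Set ℝ} {M : ℕ}
    (hf : ContinuousOn (fun z : ℝ × ℝ => f z.1 z.2) (I ×ˢ univ))
    (hf' : ContinuousOn (fun z : ℝ × ℝ => deriv (f z.1) z.2) (I ×ˢ univ))
    (hC1 : ∀ μ ∈ I, ContDiff ℝ 1 (f μ)) (hμ₁ : μ₁ ∈ I) (hU : U ∈ nhds x₀)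
    (hM : (f μ₁)^[M] x₀ = p) (hd : ∀ j < M, deriv (f μ₁) ((f μ₁)^[j] x₀) ≠ 0) :
    ∀ᶠ μ in nhdsWithin μ₁ I, ∃ y ∈ U, (f μ)^[M] y = p ∧
      ∀ j < M, deriv (f μ) ((f μ)^[j] y) ≠ 0 := by
  have hev : ∀ᶠ z in nhdsWithin μ₁ I ×ˢ nhds x₀, ∀ j ∈ Finset.range M,
      deriv (f z.1) ((f z.1)^[j] z.2) ≠ 0 := by
    rw [Filter.eventually_all_finset]
    intro j hj
    have h := (hf'.comp (continuousOn_fst.prodMk (continuousOn_uncurry_iterate hf j))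
      fun z hz => ⟨hz.1, mem_univ _⟩) (μ₁, x₀) ⟨hμ₁, mem_univ _⟩
    have h' := h.eventually_ne (hd j (Finset.mem_range.1 hj))
    rwa [nhdsWithin_prod_eq, nhdsWithin_univ] at h'
  obtain ⟨P, hP, Q, hQ, hPQ⟩ := eventually_prod_iff.1 hev
  obtain ⟨η, hη, hηQ⟩ := Metric.nhds_basis_ball.eventually_iff.1 (hQ.and hU)
  have himg : (f μ₁)^[M] '' Metric.ball x₀ η ∈ nhds p := by
    rw [← hM, ← map_iterate_nhds (hC1 μ₁ hμ₁) hd]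
    exact image_mem_map (Metric.ball_mem_nhds x₀ hη)
  obtain ⟨e, he, hsub⟩ := Metric.nhds_basis_closedBall.mem_iff.1 himg
  rw [Real.closedBall_eq_Icc] at hsub
  obtain ⟨u, hu, hue⟩ := hsub (⟨le_rfl, by linarith⟩ : p - e ∈ Icc (p - e) (p + e))
  obtain ⟨v, hv, hve⟩ := hsub (⟨by linarith, le_rfl⟩ : p + e ∈ Icc (p - e) (p + e))
  have hlim : ∀ w, Tendsto (fun μ => (f μ)^[M] w) (nhdsWithin μ₁ I) (nhds ((f μ₁)^[M] w)) :=
    fun w => (continuousOn_uncurry_iterate hf M).comp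
      (continuousOn_id.prodMk continuousOn_const) (fun _ h => ⟨h, mem_univ _⟩) μ₁ hμ₁
  filter_upwards [hP, self_mem_nhdsWithin,
    (hlim u).eventually_lt_const (by linarith : (f μ₁)^[M] u < p),
    (hlim v).eventually_const_lt (by linarith : p < (f μ₁)^[M] v)] with μ hPμ hμ h1 h2
  obtain ⟨y, hy, hyp⟩ := Metric.isPreconnected_ball.intermediate_value hu hv
    ((hC1 μ hμ).continuous.iterate M).continuousOn ⟨h1.le, h2.le⟩
  exact ⟨y, (hηQ hy).2, hyp, fun j hj => hPQ hPμ (hηQ hy).1 j (Finset.mem_range.2 hj)⟩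

/-- Strong perturbations do not create preimages of `p` in a closed set avoiding them. -/
lemma eventually_forall_apply_ne {p μ₁ : ℝ}
    (hcont : ∀ ε : ℝ → ℝ, Continuous ε → (∀ x, 0 < ε x) →
      ∃ δ > (0 : ℝ), ∀ μ ∈ I, |μ - μ₁| < δ → ∀ x : ℝ, |f μ x - f μ₁ x| < ε x)
    (hf : Continuous (f μ₁)) {S : Set ℝ} (hS : IsClosed S) (hne : ∀ x ∈ S, f μ₁ x ≠ p) :
    ∀ᶠ μ in nhdsWithin μ₁ I, ∀ x ∈ S, f μ x ≠ p := by
  rcases S.eq_empty_or_nonempty with rfl | hSne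
  · simp
  obtain ⟨δ, hδ, h⟩ := hcont (fun x => |f μ₁ x - p| + Metric.infDist x S)
    ((hf.sub continuous_const).abs.add (Metric.continuous_infDist_pt S)) fun x => by
      by_cases hx : x ∈ S
      · exact add_pos_of_pos_of_nonneg (abs_pos.2 (sub_ne_zero.2 (hne x hx)))
          Metric.infDist_nonneg
      · exact add_pos_of_nonneg_of_pos (abs_nonneg _) ((hS.notMem_iff_infDist_pos hSne).1 hx)
  filter_upwards [self_mem_nhdsWithin, mem_nhdsWithin_of_mem_nhds (Metric.ball_mem_nhds μ₁ hδ)]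
    with μ hμ hμδ x hx hfx
  have := h μ hμ hμδ x
  rw [hfx, Metric.infDist_zero_of_mem hx, add_zero, abs_sub_comm] at this
  exact lt_irrefl _ this

end Families

section UnstableEndpoints

variable {I : Set ℝ} {f : ℝ → ℝ → ℝ} {p μ₁ : ℝ}

/-- If the upper end of the unstable set varies continuously and the unstable set contains no
preimage of `p` other than `p`, then nearby maps have no such preimage to the right of `p + r`. -/
lemma eventually_forall_right_apply_ne
    (hcont : ∀ ε : ℝ → ℝ, Continuous ε → (∀ x, 0 < ε x) →
      ∃ δ > (0 : ℝ), ∀ μ ∈ I, |μ - μ₁| < δ → ∀ x : ℝ, |f μ x - f μ₁ x| < ε x)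
    (hf : Continuous (f μ₁)) (hp : f μ₁ p = p) {r : ℝ} (hr : 0 < r)
    (hW : Icc (p - r) (p + r) ⊆ unstableSet (f μ₁) p)
    (hinj : ∀ q ∈ unstableSet (f μ₁) p, f μ₁ q = p → q = p)
    (hb : ContinuousWithinAt
      (fun μ => sSup ((fun x : ℝ => (x : EReal)) '' unstableSet (f μ) p)) I μ₁) :
    ∀ᶠ μ in nhdsWithin μ₁ I, ∀ q ∈ unstableSet (f μ) p, p + r ≤ q → f μ q ≠ p := by
  rcases Ici_subset_or_exists_forall_Ioc_apply_ne hf (ordConnected_unstableSet hf hp hr hW)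
    image_unstableSet (self_mem_unstableSet hp) hinj
    ⟨p + r, hW ⟨by linarith, le_rfl⟩, by linarith⟩ with h | ⟨β, β', hββ', hβ, hne⟩
  · filter_upwards [eventually_forall_apply_ne hcont hf (isClosed_Ici (a := p + r))
      fun x hx hfx => by
        have hx' : p + r ≤ x := hx
        have := hinj x (h (show p ≤ x by linarith)) hfx
        linarith] with μ hμ q _ hq
    exact hμ q hq
  · have hlt : sSup ((fun x : ℝ => (x : EReal)) '' unstableSet (f μ₁) p) < (β' : EReal) := by
      refine (sSup_le ?_).trans_lt (EReal.coe_lt_coe_iff.2 hββ')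
      rintro _ ⟨x, hx, rfl⟩
      exact EReal.coe_le_coe_iff.2 (hβ hx)
    filter_upwards [hb.eventually_lt_const hlt,
      eventually_forall_apply_ne hcont hf (isClosed_Icc (a := p + r) (b := β'))
        fun x hx => hne x ⟨by linarith [hx.1], hx.2⟩] with μ hμ1 hμ2 q hqW hq
    exact hμ2 q ⟨hq, EReal.coe_le_coe_iff.1 ((le_sSup (mem_image_of_mem _ hqW)).trans hμ1.le)⟩

/-- If the lower end of the unstable set varies continuously and the unstable set contains no
preimage of `p` other than `p`, then nearby maps have no such preimage to the left of `p - r`. -/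
lemma eventually_forall_left_apply_ne
    (hcont : ∀ ε : ℝ → ℝ, Continuous ε → (∀ x, 0 < ε x) →
      ∃ δ > (0 : ℝ), ∀ μ ∈ I, |μ - μ₁| < δ → ∀ x : ℝ, |f μ x - f μ₁ x| < ε x)
    (hf : Continuous (f μ₁)) (hp : f μ₁ p = p) {r : ℝ} (hr : 0 < r)
    (hW : Icc (p - r) (p + r) ⊆ unstableSet (f μ₁) p)
    (hinj : ∀ q ∈ unstableSet (f μ₁) p, f μ₁ q = p → q = p)
    (ha : ContinuousWithinAt
      (fun μ => sInf ((fun x : ℝ => (x : EReal)) '' unstableSet (f μ) p)) I μ₁) :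
    ∀ᶠ μ in nhdsWithin μ₁ I, ∀ q ∈ unstableSet (f μ) p, q ≤ p - r → f μ q ≠ p := by
  rcases Iic_subset_or_exists_forall_Ico_apply_ne hf (ordConnected_unstableSet hf hp hr hW)
    image_unstableSet (self_mem_unstableSet hp) hinj
    ⟨p - r, hW ⟨le_rfl, by linarith⟩, by linarith⟩ with h | ⟨β, β', hββ', hβ, hne⟩
  · filter_upwards [eventually_forall_apply_ne hcont hf (isClosed_Iic (a := p - r))
      fun x hx hfx => by
        have hx' : x ≤ p - r := hx
        have := hinj x (h (show x ≤ p by linarith)) hfx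
        linarith] with μ hμ q _ hq
    exact hμ q hq
  · have hlt : (β' : EReal) < sInf ((fun x : ℝ => (x : EReal)) '' unstableSet (f μ₁) p) := by
      refine (EReal.coe_lt_coe_iff.2 hββ').trans_le (le_sInf ?_)
      rintro _ ⟨x, hx, rfl⟩
      exact EReal.coe_le_coe_iff.2 (hβ hx)
    filter_upwards [ha.eventually_const_lt hlt,
      eventually_forall_apply_ne hcont hf (isClosed_Icc (a := β') (b := p - r))
        fun x hx => hne x ⟨hx.1, by linarith [hx.2]⟩] with μ hμ1 hμ2 q hqW hq
    exact hμ2 q ⟨EReal.coe_le_coe_iff.1 (hμ1.le.trans (sInf_le (mem_image_of_mem _ hqW))), hq⟩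

end UnstableEndpoints

section Persistence

variable {I : Set ℝ} {f : ℝ → ℝ → ℝ} {p μ₁ : ℝ}

/-- Regular homoclinic orbits of a repelling fixed point persist under perturbation. -/
lemma eventually_exists_regular_homoclinic
    (hf : ContinuousOn (fun z : ℝ × ℝ => f z.1 z.2) (I ×ˢ univ))
    (hf' : ContinuousOn (fun z : ℝ × ℝ => deriv (f z.1) z.2) (I ×ˢ univ))
    (hC1 : ∀ μ ∈ I, ContDiff ℝ 1 (f μ)) (hμ₁ : μ₁ ∈ I) (hfix : ∀ μ ∈ I, f μ p = p)
    (hrep : 1 < |deriv (f μ₁) p|)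
    {x : ℤ → ℝ} (hx : ∀ n, f μ₁ (x (n + 1)) = x n) (htop : Tendsto x atTop (nhds p))
    (hbot : Tendsto x atBot (nhds p)) (hne : ∃ N, x N ≠ p)
    (hreg : ∀ n, deriv (f μ₁) (x n) ≠ 0) :
    ∀ᶠ μ in nhdsWithin μ₁ I, ∃ x : ℤ → ℝ, (∀ n, f μ (x (n + 1)) = x n) ∧
      Tendsto x atTop (nhds p) ∧ Tendsto x atBot (nhds p) ∧ (∃ N, x N ≠ p) ∧
      ∀ n, deriv (f μ) (x n) ≠ 0 := by
  obtain ⟨r, l, σ, hr, hl, hσ, hexp⟩ :=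
    exists_uniform_expansion (D := fun μ => deriv (f μ)) hf' hμ₁ hrep
  obtain ⟨N, hN⟩ := exists_forall_le_eq_of_tendsto_atBot
    ((hC1 μ₁ hμ₁).differentiable one_ne_zero) hσ hr hl (hfix μ₁ hμ₁)
    (hexp.self_of_nhdsWithin hμ₁) hx hbot
  obtain ⟨K, hK⟩ := hne
  obtain ⟨n, hnK, hnN, hn⟩ := ((eventually_ge_atTop K).and ((eventually_ge_atTop N).and
    (htop.eventually_mem
      (Ioo_mem_nhds (by linarith : p - r < p) (by linarith : p < p + r))))).exists
  have hnp : x n ≠ p := fun h => hK <| by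
    have h2 := apply_iterate_of_backward_orbit hx (n - K).toNat n
    rw [h, Function.iterate_fixed (hfix μ₁ hμ₁)] at h2
    rw [h2]
    congr 1
    omega
  have hM : (f μ₁)^[(n - N).toNat] (x n) = p := by
    rw [apply_iterate_of_backward_orbit hx]
    exact hN _ (by omega)
  filter_upwards [hexp, self_mem_nhdsWithin, eventually_exists_iterate_eq hf hf' hC1 hμ₁
    (inter_mem (Ioo_mem_nhds hn.1 hn.2) (isOpen_ne.mem_nhds hnp)) hM
    fun j _ => by rw [apply_iterate_of_backward_orbit hx]; exact hreg _] with μ hd hμ hy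
  obtain ⟨y, ⟨hyI, hyp⟩, hyM, hyd⟩ := hy
  obtain ⟨s, rfl, hs1, hs2, hs3⟩ := exists_local_preorbit
    ((hC1 μ hμ).differentiable one_ne_zero) hσ hr hl (hfix μ hμ) hd (Ioo_subset_Icc_self hyI)
  obtain ⟨z, hz1, hz2, hz3, hz4, hz5⟩ := exists_biinfinite_orbit (hfix μ hμ) hs1 hs2 hyM
  have hloc : ∀ w ∈ Icc (p - r) (p + r), deriv (f μ) w ≠ 0 := fun w hw h => by
    have := hd w hw
    rw [h, mul_zero] at this
    linarith
  refine ⟨z, hz1, hz2, hz3, ⟨0, hz4 ▸ hyp⟩, fun m => ?_⟩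
  rcases hz5 m with ⟨k, hk⟩ | ⟨k, hkM, hk⟩ | hk
  · rw [hk]; exact hloc _ (hs3 k)
  · rw [hk]; exact hyd k hkM
  · rw [hk]; exact hloc _ ⟨by linarith, by linarith⟩

end Persistence

/-- (Theorem on the last homoclinic parameter, dimension one.)
For a family `(f_μ)_{μ∈[0,1]}` of `C¹` maps of `ℝ`, continuous in the strong `C¹`
topology, with a persistent repellor fixed point `p`, such that `f_0` has a
regular homoclinic orbit associated to `p` and `f_1` has none, let
`μ₀ = sup{μ : f_μ has a regular homoclinic orbit associated to p}`. Then either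
one of the endpoint functions `a(μ) = inf W^u_{f_μ}(p)`, `b(μ) = sup W^u_{f_μ}(p)`
is discontinuous at `μ₀`, or `f_{μ₀}` has a critical homoclinic orbit and no
regular homoclinic orbit associated to `p`. -/
theorem last_homoclinic_parameter_bifurcation
    (f : ℝ → ℝ → ℝ)
    (hC1 : ∀ μ ∈ Icc (0 : ℝ) 1, ContDiff ℝ 1 (f μ))
    (hcont : ∀ μ₁ ∈ Icc (0 : ℝ) 1, ∀ ε : ℝ → ℝ, Continuous ε → (∀ x, 0 < ε x) →
      ∃ δ > (0 : ℝ), ∀ μ ∈ Icc (0 : ℝ) 1, |μ - μ₁| < δ → ∀ x : ℝ,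
        |f μ x - f μ₁ x| < ε x ∧ |deriv (f μ) x - deriv (f μ₁) x| < ε x)
    (p : ℝ) (hfix : ∀ μ ∈ Icc (0 : ℝ) 1, f μ p = p)
    (hrep : ∀ μ ∈ Icc (0 : ℝ) 1, 1 < |deriv (f μ) p|)
    -- homoclinic orbits for the parameter μ
    (Hom RegHom CritHom : ℝ → Prop)
    (hHom : ∀ μ : ℝ, Hom μ ↔ ∃ x : ℤ → ℝ, (∀ n : ℤ, f μ (x (n + 1)) = x n) ∧
      Tendsto x atTop (nhds p) ∧ Tendsto x atBot (nhds p) ∧ ∃ N : ℤ, x N ≠ p)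
    (hRegHom : ∀ μ : ℝ, RegHom μ ↔ ∃ x : ℤ → ℝ,
      (∀ n : ℤ, f μ (x (n + 1)) = x n) ∧
      Tendsto x atTop (nhds p) ∧ Tendsto x atBot (nhds p) ∧ (∃ N : ℤ, x N ≠ p) ∧
      ∀ n : ℤ, deriv (f μ) (x n) ≠ 0)
    (hCritHom : ∀ μ : ℝ, CritHom μ ↔ ∃ x : ℤ → ℝ,
      (∀ n : ℤ, f μ (x (n + 1)) = x n) ∧
      Tendsto x atTop (nhds p) ∧ Tendsto x atBot (nhds p) ∧ (∃ N : ℤ, x N ≠ p) ∧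
      ∃ n : ℤ, deriv (f μ) (x n) = 0)
    (h0 : RegHom 0) (h1 : ¬ Hom 1)
    (μ₀ : ℝ) (hμ₀ : μ₀ = sSup {μ ∈ Icc (0 : ℝ) 1 | RegHom μ})
    -- the endpoints of the unstable set, as extended reals
    (W : ℝ → Set ℝ)
    (hW : ∀ μ : ℝ, W μ = {y | ∃ s : ℕ → ℝ, s 0 = y ∧
      (∀ n : ℕ, f μ (s (n + 1)) = s n) ∧ Tendsto s atTop (nhds p)})
    (a b : ℝ → EReal)
    (ha : ∀ μ : ℝ, a μ = sInf ((fun x : ℝ => (x : EReal)) '' W μ))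
    (hb : ∀ μ : ℝ, b μ = sSup ((fun x : ℝ => (x : EReal)) '' W μ)) :
    (¬ ContinuousWithinAt a (Icc (0 : ℝ) 1) μ₀ ∨
     ¬ ContinuousWithinAt b (Icc (0 : ℝ) 1) μ₀) ∨
    (CritHom μ₀ ∧ ¬ RegHom μ₀) := by
  obtain rfl : W = fun μ => unstableSet (f μ) p := funext hW
  obtain rfl := funext ha
  obtain rfl := funext hb
  set I := Icc (0 : ℝ) 1
  have hf : ContinuousOn (fun z : ℝ × ℝ => f z.1 z.2) (I ×ˢ univ) :=
    continuousOn_uncurry_of_uniform (fun μ hμ => (hC1 μ hμ).continuous) fun μ₁ hμ₁ ε hε => by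
      obtain ⟨δ, hδ, h⟩ := hcont μ₁ hμ₁ (fun _ => ε) continuous_const fun _ => hε
      exact ⟨δ, hδ, fun μ hμ hμδ x => (h μ hμ hμδ x).1⟩
  have hf' : ContinuousOn (fun z : ℝ × ℝ => deriv (f z.1) z.2) (I ×ˢ univ) :=
    continuousOn_uncurry_of_uniform (G := fun μ => deriv (f μ))
      (fun μ hμ => (hC1 μ hμ).continuous_deriv le_rfl) fun μ₁ hμ₁ ε hε => by
      obtain ⟨δ, hδ, h⟩ := hcont μ₁ hμ₁ (fun _ => ε) continuous_const fun _ => hε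
      exact ⟨δ, hδ, fun μ hμ hμδ x => (h μ hμ hμδ x).2⟩
  have h0I : (0 : ℝ) ∈ I := ⟨le_rfl, zero_le_one⟩
  have hbdd : BddAbove {μ ∈ I | RegHom μ} := ⟨1, fun μ hμ => hμ.1.2⟩
  have hnonempty : {μ ∈ I | RegHom μ}.Nonempty := ⟨0, h0I, h0⟩
  have hμ₀I : μ₀ ∈ I := by
    rw [hμ₀]
    exact ⟨le_csSup hbdd ⟨h0I, h0⟩, csSup_le hnonempty fun μ hμ => hμ.1.2⟩
  have hregHom : ∀ μ, RegHom μ → Hom μ := fun μ h => by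
    obtain ⟨x, h1, h2, h3, h4, -⟩ := (hRegHom μ).1 h
    exact (hHom μ).2 ⟨x, h1, h2, h3, h4⟩
  have hnot : ¬ RegHom μ₀ := by
    intro h
    have hlt : μ₀ < 1 := hμ₀I.2.lt_of_ne fun h' => h1 (hregHom 1 (h' ▸ h))
    obtain ⟨x, hx1, hx2, hx3, hx4, hx5⟩ := (hRegHom μ₀).1 h
    have hev := eventually_exists_regular_homoclinic hf hf' hC1 hμ₀I hfix (hrep μ₀ hμ₀I)
      hx1 hx2 hx3 hx4 hx5
    have hle : nhdsWithin μ₀ (Ioo μ₀ 1) ≤ nhdsWithin μ₀ I :=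
      nhdsWithin_mono _ fun μ hμ => ⟨hμ₀I.1.trans hμ.1.le, hμ.2.le⟩
    have : (nhdsWithin μ₀ (Ioo μ₀ 1)).NeBot := left_nhdsWithin_Ioo_neBot hlt
    obtain ⟨μ, hμ, hμIoo⟩ := ((hev.filter_mono hle).and self_mem_nhdsWithin).exists
    have := le_csSup hbdd (⟨⟨hμ₀I.1.trans hμIoo.1.le, hμIoo.2.le⟩, (hRegHom μ).2 hμ⟩ :
      μ ∈ {μ ∈ I | RegHom μ})
    rw [← hμ₀] at this
    exact this.not_gt hμIoo.1
  by_contra hcon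
  push Not at hcon
  obtain ⟨⟨hacont, hbcont⟩, hcrit⟩ := hcon
  have hnoHom : ¬ Hom μ₀ := fun h => by
    obtain ⟨x, hx1, hx2, hx3, hx4⟩ := (hHom μ₀).1 h
    by_cases hd : ∀ n, deriv (f μ₀) (x n) ≠ 0
    · exact hnot ((hRegHom μ₀).2 ⟨x, hx1, hx2, hx3, hx4, hd⟩)
    · push Not at hd
      exact hnot (hcrit ((hCritHom μ₀).2 ⟨x, hx1, hx2, hx3, hx4, hd⟩))
  have hinj : ∀ q ∈ unstableSet (f μ₀) p, f μ₀ q = p → q = p := by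
    rintro q ⟨s, rfl, hs1, hs2⟩ hq
    by_contra hqp
    obtain ⟨x, hx1, hx2, hx3, hx4, -⟩ :=
      exists_biinfinite_orbit (hfix μ₀ hμ₀I) hs1 hs2 (M := 1) hq
    exact hnoHom ((hHom μ₀).2 ⟨x, hx1, hx2, hx3, 0, hx4 ▸ hqp⟩)
  obtain ⟨r, l, σ, hr, hl, hσ, hexp⟩ :=
    exists_uniform_expansion (D := fun μ => deriv (f μ)) hf' hμ₀I (hrep μ₀ hμ₀I)
  have hC : Continuous (f μ₀) := (hC1 μ₀ hμ₀I).continuous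
  have hWsub := Icc_subset_unstableSet ((hC1 μ₀ hμ₀I).differentiable one_ne_zero) hσ hr hl
    (hfix μ₀ hμ₀I) (hexp.self_of_nhdsWithin hμ₀I)
  have hcont₀ : ∀ ε : ℝ → ℝ, Continuous ε → (∀ x, 0 < ε x) →
      ∃ δ > (0 : ℝ), ∀ μ ∈ I, |μ - μ₀| < δ → ∀ x : ℝ, |f μ x - f μ₀ x| < ε x :=
    fun ε hε hε0 => by
      obtain ⟨δ, hδ, h⟩ := hcont μ₀ hμ₀I ε hε hε0
      exact ⟨δ, hδ, fun μ hμ hμδ x => (h μ hμ hμδ x).1⟩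
  have hev := hexp.and ((eventually_forall_right_apply_ne hcont₀ hC (hfix μ₀ hμ₀I) hr hWsub hinj
    hbcont).and (eventually_forall_left_apply_ne hcont₀ hC (hfix μ₀ hμ₀I) hr hWsub hinj hacont))
  have hfreq : ∃ᶠ μ in nhdsWithin μ₀ I, RegHom μ := by
    have hmem := csSup_mem_closure hnonempty hbdd
    rw [← hμ₀, mem_closure_iff_frequently] at hmem
    rw [frequently_nhdsWithin_iff]
    exact hmem.mono fun μ hμ => ⟨hμ.2, hμ.1⟩
  obtain ⟨μ, ⟨hreg, hμI⟩, hd, hright, hleft⟩ :=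
    ((hfreq.and_eventually self_mem_nhdsWithin).and_eventually hev).exists
  obtain ⟨x, hx1, hx2, hx3, hx4, -⟩ := (hRegHom μ).1 hreg
  have hdiff := (hC1 μ hμI).differentiable one_ne_zero
  obtain ⟨q, hqW, hqp, hfq⟩ := exists_mem_unstableSet_apply_eq hx1 hx2 hx4
    (exists_forall_le_eq_of_tendsto_atBot hdiff hσ hr hl (hfix μ hμI) hd hx1 hx3)
  have hq1 : q < p + r := lt_of_not_ge fun h => hright q hqW h hfq
  have hq2 : p - r < q := lt_of_not_ge fun h => hleft q hqW h hfq
  have h := mul_abs_sub_le_of_le_deriv hdiff hσ hd (⟨hq2.le, hq1.le⟩ : q ∈ Icc (p - r) (p + r))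
    (⟨by linarith, by linarith⟩ : p ∈ Icc (p - r) (p + r))
  rw [hfq, hfix μ hμI, sub_self, abs_zero] at h
  nlinarith [abs_pos.2 (sub_ne_zero.2 hqp)]
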